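/- Let 1 ≤ q < ∞, ω ≥ 0, and let A be an operator on L^q(Σ,μ) such that A + ωI is m-accretive in L^q(Σ,μ). Assume A satisfies the L^q–L^r Gagliardo–Nirenberg inequality with differences: there are 1 ≤ r ≤ ∞, ϱ ≥ 0, σ > 0 and C > 0 such that ‖u − û‖_r^σ ≤ C·([u − û, v − v̂]_q + ω‖u − û‖_q^q)·‖u − û‖_q^ϱ for all (u,v),(û,v̂) ∈ A. Let (T_t)_{t≥0} be the semigroup generated by −A on the closure of D(A) in L^q(Σ,μ), and assume it has exponential growth in L^r: ‖T_t u − T_t û‖_r ≤ e^{ωt}‖u − û‖_r (in [0,∞]) for all t ≥ 0 and all u, û in the closure of D(A). Then, with α := 1/σ, γ := (q+ϱ)/σ and β := γ + 1, one has ‖T_t u − T_t û‖_r ≤ (C/q)^{1/σ}·t^{−α}·e^{ωβt}·‖u − û‖_q^γ for every t > 0 and all u, û in the closure of D(A) in L^q(Σ,μ). -/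

import Mathlib

open MeasureTheory Filter ENNReal

namespace Statement0

variable {α : Type*} [MeasurableSpace α]

/-- The `q`-bracket `[u,v]_q = inf_{λ>0} (‖u+λv‖_q^q − ‖u‖_q^q)/(qλ)`. -/
noncomputable def qBracket (μ : Measure α) (q : ℝ) (u v : α → ℝ) : ℝ :=
  sInf { c : ℝ | ∃ l : ℝ, 0 < l ∧
    c = ((eLpNorm (u + l • v) (ENNReal.ofReal q) μ).toReal ^ q -
          (eLpNorm u (ENNReal.ofReal q) μ).toReal ^ q) / (q * l) }

/-- Membership in the closure (with respect to the `L^p(Σ,μ)`-distance) of a subset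
`S` of `L^p(Σ,μ)`. -/
def MemLpClosure (μ : Measure α) (p : ℝ≥0∞) (S : Set (Lp ℝ p μ)) (u : Lp ℝ p μ) : Prop :=
  ∀ ε : ℝ, 0 < ε → ∃ w ∈ S, eLpNorm (⇑(u - w)) p μ < ENNReal.ofReal ε

/-- The operator `A + ω I` is accretive in `L^p(Σ,μ)`:
`‖u − û‖_p ≤ ‖(u − û) + λ((v + ωu) − (v̂ + ωû))‖_p` for all `(u,v), (û,v̂) ∈ A`, `λ ≥ 0`. -/
def IsAccretiveShift (μ : Measure α) (p : ℝ≥0∞) (ω : ℝ)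
    (A : Set (Lp ℝ p μ × Lp ℝ p μ)) : Prop :=
  ∀ uv ∈ A, ∀ uv' ∈ A, ∀ l : ℝ, 0 ≤ l →
    eLpNorm (⇑(uv.1 - uv'.1)) p μ ≤
      eLpNorm (⇑(uv.1 - uv'.1 + l • ((uv.2 + ω • uv.1) - (uv'.2 + ω • uv'.1)))) p μ

/-- The operator `A + ω I` is m-accretive in `L^p(Σ,μ)`: it is accretive and satisfies
the range condition `Rg(I + λ(A + ωI)) = L^p(Σ,μ)` for all `λ > 0`. -/
def IsMAccretiveShift (μ : Measure α) (p : ℝ≥0∞) (ω : ℝ)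
    (A : Set (Lp ℝ p μ × Lp ℝ p μ)) : Prop :=
  IsAccretiveShift μ p ω A ∧
    ∀ l : ℝ, 0 < l → ∀ f : Lp ℝ p μ, ∃ uv ∈ A, uv.1 + l • (uv.2 + ω • uv.1) = f

/-- `J` is the resolvent family of `A`: `J_λ (u + λ v) = u` for `(u,v) ∈ A`
and `0 < λ` with `λ ω < 1`. -/
def IsResolventFamily (μ : Measure α) (p : ℝ≥0∞) (ω : ℝ)
    (A : Set (Lp ℝ p μ × Lp ℝ p μ)) (J : ℝ → Lp ℝ p μ → Lp ℝ p μ) : Prop :=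
  ∀ l : ℝ, 0 < l → l * ω < 1 → ∀ uv ∈ A, J l (uv.1 + l • uv.2) = uv.1

/-- `T` is the semigroup generated by `−A` on the closure of `D(A)` in `L^p(Σ,μ)`:
`J` is the resolvent family of `A`, `T` maps the closure of `D(A)` into itself, `T_0 = id`,
`T` satisfies the semigroup property, and the implicit Euler scheme (Crandall–Liggett
exponential formula) `max_{0 ≤ k ≤ n} ‖(J_{t/n})^k u − T_{kt/n} u‖_p → 0` holds. -/
def IsGeneratedSemigroup (μ : Measure α) (p : ℝ≥0∞) (ω : ℝ)
    (A : Set (Lp ℝ p μ × Lp ℝ p μ)) (J T : ℝ → Lp ℝ p μ → Lp ℝ p μ) : Prop :=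
  IsResolventFamily μ p ω A J ∧
  (∀ t : ℝ, 0 ≤ t → ∀ u, MemLpClosure μ p (Prod.fst '' A) u →
      MemLpClosure μ p (Prod.fst '' A) (T t u)) ∧
  (∀ u, MemLpClosure μ p (Prod.fst '' A) u → T 0 u = u) ∧
  (∀ s t : ℝ, 0 ≤ s → 0 ≤ t → ∀ u, MemLpClosure μ p (Prod.fst '' A) u →
      T (t + s) u = T t (T s u)) ∧
  (∀ u, MemLpClosure μ p (Prod.fst '' A) u → ∀ t : ℝ, 0 < t →
      Tendsto (fun n : ℕ => ⨆ k ∈ Finset.range (n + 1),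
          eLpNorm (⇑((J (t / (n : ℝ)))^[k] u - T ((k : ℝ) * t / (n : ℝ)) u)) p μ)
        atTop (nhds 0))

lemma gn_pick (a : ℕ → ℝ) (ha : ∀ k, 0 ≤ a k) (θ : ℝ) (h0 : 0 < θ) (h1 : θ ≤ 1) (n : ℕ)
    (hn : 0 < n) : ∃ k < n, a k - θ * a (k + 1) ≤ a 0 / (n * θ ^ n) := by
  by_contra hcon
  push Not at hcon
  have hn' : (0 : ℝ) < n := by exact_mod_cast hn
  have tel : ∀ m : ℕ, ∑ k ∈ Finset.range m, θ ^ k * (a k - θ * a (k + 1)) = a 0 - θ ^ m * a m := by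
    intro m
    induction m with
    | zero => simp
    | succ m ih => rw [Finset.sum_range_succ, ih]; ring
  have hlt : ∑ k ∈ Finset.range n, a 0 / n <
      ∑ k ∈ Finset.range n, θ ^ k * (a k - θ * a (k + 1)) := by
    apply Finset.sum_lt_sum_of_nonempty (by simpa using hn.ne')
    intro k hk
    have hk' := Finset.mem_range.1 hk
    have h2 := hcon k hk'
    have h3 : θ ^ n ≤ θ ^ k := pow_le_pow_of_le_one h0.le h1 hk'.le
    have h4 : 0 ≤ a 0 / (n * θ ^ n) := div_nonneg (ha 0) (by positivity)
    calc a 0 / n = θ ^ n * (a 0 / (n * θ ^ n)) := by field_simp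
      _ ≤ θ ^ k * (a 0 / (n * θ ^ n)) := by gcongr
      _ < θ ^ k * (a k - θ * a (k + 1)) := by gcongr
  rw [tel] at hlt
  have h5 : 0 ≤ θ ^ n * a n := mul_nonneg (by positivity) (ha n)
  have h6 : ∑ k ∈ Finset.range n, a 0 / (n : ℝ) = a 0 := by
    simp; field_simp
  linarith

lemma gn_lsc (μ : Measure α) (p r : ℝ≥0∞) [Fact (1 ≤ p)] (W : Lp ℝ p μ) (b e : ℕ → ℝ≥0∞)
    (B : ℝ≥0∞) (hb : Tendsto b atTop (nhds B)) (he : Tendsto e atTop (nhds 0))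
    (h : ∀ᶠ n in atTop, ∃ w : Lp ℝ p μ, eLpNorm (⇑w) r μ ≤ b n ∧ ‖w - W‖ₑ ≤ e n) :
    eLpNorm (⇑W) r μ ≤ B := by
  obtain ⟨N, hN⟩ := eventually_atTop.1 h
  have h' : ∀ n, ∃ w : Lp ℝ p μ, eLpNorm (⇑w) r μ ≤ b (n + N) ∧ ‖w - W‖ₑ ≤ e (n + N) :=
    fun n => hN (n + N) (by omega)
  choose w hw1 hw2 using h'
  have hb' : Tendsto (fun n => b (n + N)) atTop (nhds B) := hb.comp (tendsto_add_atTop_nat N)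
  have he' : Tendsto (fun n => e (n + N)) atTop (nhds 0) := he.comp (tendsto_add_atTop_nat N)
  have hlim : Tendsto w atTop (nhds W) := by
    rw [tendsto_iff_edist_tendsto_0]
    refine tendsto_of_tendsto_of_tendsto_of_le_of_le tendsto_const_nhds he' (fun _ => zero_le) ?_
    intro n
    simpa [edist_eq_enorm_sub] using hw2 n
  obtain ⟨ns, hns, hae⟩ := (tendstoInMeasure_of_tendsto_Lp hlim).exists_seq_tendsto_ae
  have h1 := Lp.eLpNorm_lim_le_liminf_eLpNorm (p := r)
    (fun n => Lp.aestronglyMeasurable (w (ns n))) (⇑W) hae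
  refine h1.trans ?_
  have h2 : Tendsto (fun n => b (ns n + N)) atTop (nhds B) := hb'.comp hns.tendsto_atTop
  rw [← h2.liminf_eq]
  exact liminf_le_liminf (Eventually.of_forall fun n => hw1 (ns n))

section resolvent

variable {μ : Measure α} {p : ℝ≥0∞} {ω : ℝ} {A : Set (Lp ℝ p μ × Lp ℝ p μ)}
  {J : ℝ → Lp ℝ p μ → Lp ℝ p μ}

lemma gn_res (hA : IsMAccretiveShift μ p ω A) (hJ : IsResolventFamily μ p ω A J)
    (l : ℝ) (hl : 0 < l) (hlω : l * ω < 1) (f : Lp ℝ p μ) :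
    ∃ uv ∈ A, uv.1 + l • uv.2 = f ∧ J l f = uv.1 := by
  have h1 : 0 < 1 - l * ω := by linarith
  obtain ⟨uv, huv, h⟩ := hA.2 (l / (1 - l * ω)) (by positivity) ((1 / (1 - l * ω)) • f)
  have key : uv.1 + l • uv.2 = f := by
    have h2 := congrArg (fun x => (1 - l * ω) • x) h
    simp only [smul_smul, smul_add] at h2
    rw [mul_one_div_cancel h1.ne', one_smul, mul_div_cancel₀ _ h1.ne', ← add_assoc,
      add_right_comm, ← add_smul] at h2
    rw [← h2]; congr 1
    rw [show 1 - l * ω + (1 - l * ω) * (l / (1 - l * ω) * ω) = 1 by field_simp; ring, one_smul]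
  exact ⟨uv, huv, key, by rw [← key]; exact hJ l hl hlω uv huv⟩

lemma gn_toReal (f : Lp ℝ p μ) : (eLpNorm (⇑f) p μ).toReal = ‖f‖ := (Lp.norm_def f).symm

lemma gn_lip [Fact (1 ≤ p)] (hA : IsMAccretiveShift μ p ω A) (hJ : IsResolventFamily μ p ω A J)
    (l : ℝ) (hl : 0 < l) (hlω : l * ω < 1) (f g : Lp ℝ p μ) :
    ‖J l f - J l g‖ * (1 - l * ω) ≤ ‖f - g‖ := by
  obtain ⟨x, hx, hxf, hxJ⟩ := gn_res hA hJ l hl hlω f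
  obtain ⟨y, hy, hyg, hyJ⟩ := gn_res hA hJ l hl hlω g
  have h1 : 0 < 1 - l * ω := by linarith
  have h := hA.1 x hx y hy (l / (1 - l * ω)) (by positivity)
  have h2 := ENNReal.toReal_mono (Lp.eLpNorm_ne_top _) h
  rw [gn_toReal, gn_toReal] at h2
  have e : x.1 - y.1 + (l / (1 - l * ω)) • (x.2 + ω • x.1 - (y.2 + ω • y.1)) =
      (1 / (1 - l * ω)) • (f - g) := by
    rw [← hxf, ← hyg]
    match_scalars <;> field_simp <;> ring
  rw [e, norm_smul, Real.norm_of_nonneg (by positivity)] at h2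
  rw [hxJ, hyJ]
  calc ‖x.1 - y.1‖ * (1 - l * ω) ≤ (1 / (1 - l * ω) * ‖f - g‖) * (1 - l * ω) := by gcongr
    _ = ‖f - g‖ := by field_simp

lemma gn_lip_iter [Fact (1 ≤ p)] (hA : IsMAccretiveShift μ p ω A)
    (hJ : IsResolventFamily μ p ω A J)
    (l : ℝ) (hl : 0 < l) (hlω : l * ω < 1) (f g : Lp ℝ p μ) (k : ℕ) :
    ‖(J l)^[k] f - (J l)^[k] g‖ * (1 - l * ω) ^ k ≤ ‖f - g‖ := by
  have h1 : 0 < 1 - l * ω := by linarith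
  induction k with
  | zero => simp
  | succ k ih =>
    rw [Function.iterate_succ_apply', Function.iterate_succ_apply', pow_succ']
    refine le_trans ?_ ih
    rw [← mul_assoc]
    gcongr
    exact gn_lip hA hJ l hl hlω _ _

end resolvent

lemma gn_exp_lim (c : ℝ) (s : ℝ) :
    Tendsto (fun n : ℕ => (1 - s / (n : ℝ) * c) ^ n) atTop (nhds (Real.exp (-(s * c)))) := by
  refine (Real.tendsto_one_add_div_pow_exp (-(s * c))).congr fun n => ?_
  congr 1; ring

lemma gn_evlt (c s : ℝ) : ∀ᶠ n : ℕ in atTop, s / (n : ℝ) * c < 1 := by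
  have h : Tendsto (fun n : ℕ => s / (n : ℝ) * c) atTop (nhds (0 * c)) :=
    (tendsto_const_div_atTop_nhds_zero_nat s).mul_const c
  rw [zero_mul] at h
  exact h.eventually (gt_mem_nhds one_pos)

lemma gn_T_lip {μ : Measure α} {p : ℝ≥0∞} [Fact (1 ≤ p)] {ω : ℝ}
    {A : Set (Lp ℝ p μ × Lp ℝ p μ)} {J T : ℝ → Lp ℝ p μ → Lp ℝ p μ}
    (hA : IsMAccretiveShift μ p ω A) (hT : IsGeneratedSemigroup μ p ω A J T)
    (s : ℝ) (hs : 0 ≤ s) (f g : Lp ℝ p μ) (hf : MemLpClosure μ p (Prod.fst '' A) f)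
    (hg : MemLpClosure μ p (Prod.fst '' A) g) :
    ‖T s f - T s g‖ ≤ Real.exp (s * ω) * ‖f - g‖ := by
  obtain ⟨hJ, -, hT0, -, hE⟩ := hT
  rcases hs.eq_or_lt with rfl | hs
  · rw [hT0 f hf, hT0 g hg]; simp
  have conv : ∀ x, MemLpClosure μ p (Prod.fst '' A) x →
      Tendsto (fun n : ℕ => (J (s / (n : ℝ)))^[n] x) atTop (nhds (T s x)) := by
    intro x hx
    rw [tendsto_iff_edist_tendsto_0]
    refine tendsto_of_tendsto_of_tendsto_of_le_of_le' tendsto_const_nhds (hE x hx s hs)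
      (Eventually.of_forall fun _ => zero_le) ?_
    filter_upwards [eventually_gt_atTop 0] with n hn
    have hn' : (n : ℝ) ≠ 0 := by exact_mod_cast hn.ne'
    have := le_iSup₂ (f := fun (k : ℕ) (_ : k ∈ Finset.range (n + 1)) =>
      eLpNorm (⇑((J (s / (n : ℝ)))^[k] x - T ((k : ℝ) * s / (n : ℝ)) x)) p μ) n (by simp)
    rw [edist_eq_enorm_sub, Lp.enorm_def]
    rwa [show (n : ℝ) * s / n = s by field_simp] at this
  have h1 := ((conv f hf).sub (conv g hg)).norm.mul (gn_exp_lim ω s)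
  have h2 : ‖T s f - T s g‖ * Real.exp (-(s * ω)) ≤ ‖f - g‖ := by
    refine le_of_tendsto h1 ?_
    filter_upwards [eventually_gt_atTop 0, gn_evlt ω s] with n hn hlt
    exact gn_lip_iter hA hJ (s / n) (by positivity) hlt f g n
  calc ‖T s f - T s g‖ = Real.exp (s * ω) * (‖T s f - T s g‖ * Real.exp (-(s * ω))) := by
        rw [Real.exp_neg]; field_simp
    _ ≤ _ := by gcongr

lemma gn_memcl {μ : Measure α} {p : ℝ≥0∞} {S : Set (Lp ℝ p μ)} {u : Lp ℝ p μ} (hu : u ∈ S) :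
    MemLpClosure μ p S u := by
  intro ε hε
  refine ⟨u, hu, ?_⟩
  rw [sub_self, eLpNorm_congr_ae (Lp.coeFn_zero ℝ p μ)]
  simpa using hε

lemma gn_bracket (μ : Measure α) (q : ℝ) (hq : 1 ≤ q) [Fact (1 ≤ ENNReal.ofReal q)]
    (u v : Lp ℝ (ENNReal.ofReal q) μ) (l : ℝ) (hl : 0 < l) :
    qBracket μ q (⇑u) (⇑v) ≤ (‖u + l • v‖ ^ q - ‖u‖ ^ q) / (q * l) := by
  have e : ∀ l : ℝ, (eLpNorm (⇑u + l • ⇑v) (ENNReal.ofReal q) μ).toReal = ‖u + l • v‖ := by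
    intro l
    rw [← gn_toReal]
    congr 1
    apply eLpNorm_congr_ae
    filter_upwards [Lp.coeFn_add u (l • v), Lp.coeFn_smul l v] with x h1 h2
    rw [h1]; simp [h2]
  unfold qBracket
  apply csInf_le
  · refine ⟨(‖u‖ ^ q - ‖u - v‖ ^ q) / q, ?_⟩
    rintro c ⟨l, hl, rfl⟩
    rw [e, gn_toReal]
    have h1l : (0 : ℝ) < 1 + l := by linarith
    have hconv := (convexOn_rpow hq).2 (Set.mem_Ici.2 (norm_nonneg (u + l • v)))
      (Set.mem_Ici.2 (norm_nonneg (u - v)))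
      (show (0 : ℝ) ≤ 1 / (1 + l) by positivity) (show (0 : ℝ) ≤ l / (1 + l) by positivity)
      (by field_simp)
    have hn : ‖u‖ ≤ 1 / (1 + l) * ‖u + l • v‖ + l / (1 + l) * ‖u - v‖ := by
      have hu : u = (1 / (1 + l)) • (u + l • v) + (l / (1 + l)) • (u - v) := by
        match_scalars <;> field_simp
        ring
      calc ‖u‖ = ‖(1 / (1 + l)) • (u + l • v) + (l / (1 + l)) • (u - v)‖ := by rw [← hu]
        _ ≤ _ := norm_add_le _ _
        _ = _ := by
          rw [norm_smul, norm_smul, Real.norm_of_nonneg (by positivity),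
            Real.norm_of_nonneg (by positivity)]
    have h3 : ‖u‖ ^ q ≤ (1 / (1 + l) * ‖u + l • v‖ + l / (1 + l) * ‖u - v‖) ^ q :=
      Real.rpow_le_rpow (norm_nonneg _) hn (by linarith)
    simp only [smul_eq_mul] at hconv
    have h4 := h3.trans hconv
    have h5 : ‖u‖ ^ q * (1 + l) ≤ ‖u + l • v‖ ^ q + l * ‖u - v‖ ^ q := by
      calc _ ≤ (1 / (1 + l) * ‖u + l • v‖ ^ q + l / (1 + l) * ‖u - v‖ ^ q) * (1 + l) := by gcongr
        _ = _ := by field_simp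
    rw [div_le_div_iff₀ (by linarith) (by positivity)]
    nlinarith
  · exact ⟨l, hl, by rw [e, gn_toReal]⟩

/-- **`L^q`–`L^r` regularity from a Gagliardo–Nirenberg inequality with differences.**
If `A + ωI` is m-accretive in `L^q(Σ,μ)` and `A` satisfies
`‖u − û‖_r^σ ≤ C ([u − û, v − v̂]_q + ω ‖u − û‖_q^q) ‖u − û‖_q^ϱ` on `A`, and the
semigroup `T` generated by `−A` has exponential growth in `L^r`, then
`‖T_t u − T_t û‖_r ≤ (C/q)^{1/σ} t^{−1/σ} e^{ωβt} ‖u − û‖_q^γ`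
with `γ = (q+ϱ)/σ` and `β = γ + 1`. -/
theorem gagliardo_nirenberg_implies_LqLr_regularity
    (μ : Measure α) [SigmaFinite μ]
    (q : ℝ) (hq : 1 ≤ q) (ω : ℝ) (hω : 0 ≤ ω)
    (A : Set (Lp ℝ (ENNReal.ofReal q) μ × Lp ℝ (ENNReal.ofReal q) μ))
    (hA : IsMAccretiveShift μ (ENNReal.ofReal q) ω A)
    (r : ℝ≥0∞) (hr : 1 ≤ r)
    (ϱ σ C : ℝ) (hϱ : 0 ≤ ϱ) (hσ : 0 < σ) (hC : 0 < C)
    (hGN : ∀ uv ∈ A, ∀ uv' ∈ A,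
      eLpNorm (⇑(uv.1 - uv'.1)) r μ ^ σ ≤
        ENNReal.ofReal (C *
            (qBracket μ q (⇑(uv.1 - uv'.1)) (⇑(uv.2 - uv'.2)) +
              ω * (eLpNorm (⇑(uv.1 - uv'.1)) (ENNReal.ofReal q) μ).toReal ^ q) *
          (eLpNorm (⇑(uv.1 - uv'.1)) (ENNReal.ofReal q) μ).toReal ^ ϱ))
    (J T : ℝ → Lp ℝ (ENNReal.ofReal q) μ → Lp ℝ (ENNReal.ofReal q) μ)
    (hT : IsGeneratedSemigroup μ (ENNReal.ofReal q) ω A J T)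
    (hgrow : ∀ t : ℝ, 0 ≤ t → ∀ u v : Lp ℝ (ENNReal.ofReal q) μ,
      MemLpClosure μ (ENNReal.ofReal q) (Prod.fst '' A) u →
      MemLpClosure μ (ENNReal.ofReal q) (Prod.fst '' A) v →
      eLpNorm (⇑(T t u - T t v)) r μ ≤
        ENNReal.ofReal (Real.exp (ω * t)) * eLpNorm (⇑(u - v)) r μ) :
    ∀ t : ℝ, 0 < t → ∀ u v : Lp ℝ (ENNReal.ofReal q) μ,
      MemLpClosure μ (ENNReal.ofReal q) (Prod.fst '' A) u →
      MemLpClosure μ (ENNReal.ofReal q) (Prod.fst '' A) v →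
      eLpNorm (⇑(T t u - T t v)) r μ ≤
        ENNReal.ofReal ((C / q) ^ (1 / σ) * t ^ (-(1 / σ)) *
            Real.exp (ω * ((q + ϱ) / σ + 1) * t)) *
          eLpNorm (⇑(u - v)) (ENNReal.ofReal q) μ ^ ((q + ϱ) / σ) := by
  have : Fact (1 ≤ ENNReal.ofReal q) := ⟨by simpa using hq⟩
  intro t ht u v hu hv
  have hq0 : 0 < q := by linarith
  obtain ⟨hJ, hTm, hT0, hTs, hE⟩ := id hT
  set a0 := ‖u - v‖ with ha0
  -- the discrete bound
  let B : ℕ → ℝ := fun n => C * (a0 ^ q / (1 - t / (n : ℝ) * (q * ω)) ^ n / (q * t)) *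
    (a0 / (1 - t / (n : ℝ) * ω) ^ n) ^ ϱ
  let S : Lp ℝ (ENNReal.ofReal q) μ → ℕ → ℝ≥0∞ := fun x n => ⨆ k ∈ Finset.range (n + 1),
          eLpNorm (⇑((J (t / (n : ℝ)))^[k] x - T ((k : ℝ) * t / (n : ℝ)) x)) (ENNReal.ofReal q) μ
  let Binf : ℝ := C * (a0 ^ q / Real.exp (-(t * (q * ω))) / (q * t)) *
    (a0 / Real.exp (-(t * ω))) ^ ϱ
  have hB : Tendsto B atTop (nhds Binf) := by
    refine Tendsto.mul (Tendsto.const_mul _ (Tendsto.div_const (Tendsto.div tendsto_const_nhds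
      (gn_exp_lim _ _) (Real.exp_pos _).ne') _)) ?_
    exact (Tendsto.div tendsto_const_nhds (gn_exp_lim _ _) (Real.exp_pos _).ne').rpow_const
      (Or.inr hϱ)
  have main : eLpNorm (⇑(T t u - T t v)) r μ ≤
      ENNReal.ofReal (Real.exp (ω * t)) * (ENNReal.ofReal Binf) ^ (1 / σ) := by
    refine gn_lsc μ (ENNReal.ofReal q) r (T t u - T t v)
      (fun n => ENNReal.ofReal (Real.exp (ω * t)) * (ENNReal.ofReal (B n)) ^ (1 / σ))
      (fun n => ENNReal.ofReal (Real.exp (ω * t)) * (S u n + S v n)) _ ?_ ?_ ?_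
    · refine ENNReal.Tendsto.const_mul ?_ (Or.inr ENNReal.ofReal_ne_top)
      exact ((ENNReal.continuous_rpow_const).tendsto _).comp (ENNReal.tendsto_ofReal hB)
    · have h := ENNReal.Tendsto.const_mul (a := ENNReal.ofReal (Real.exp (ω * t)))
        ((hE u hu t ht).add (hE v hv t ht)) (Or.inr ENNReal.ofReal_ne_top)
      rw [add_zero, mul_zero] at h
      exact h
    · filter_upwards [eventually_gt_atTop 0, gn_evlt ω t, gn_evlt (q * ω) t] with n hn h1 h2
      have hn' : (0 : ℝ) < n := by exact_mod_cast hn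
      set l : ℝ := t / n with hl
      have hl0 : 0 < l := by positivity
      set θ : ℝ := 1 - l * (q * ω) with hθ
      have hθ0 : 0 < θ := by linarith
      have hθ1 : θ ≤ 1 := by
        have : 0 ≤ l * (q * ω) := by positivity
        linarith
      have hd0 : 0 < 1 - l * ω := by linarith
      have hd1 : 1 - l * ω ≤ 1 := by
        have : 0 ≤ l * ω := by positivity
        linarith
      obtain ⟨k, hk, hpick⟩ := gn_pick (fun k => ‖(J l)^[k] u - (J l)^[k] v‖ ^ q)
        (fun k => by positivity) θ hθ0 hθ1 n hn
      simp only [Function.iterate_zero, id] at hpick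
      have hiter := gn_lip_iter hA hJ l hl0 h1 u v (k + 1)
      simp only [Function.iterate_succ_apply'] at hpick hiter
      obtain ⟨x, hx, hxf, hxJ⟩ := gn_res hA hJ l hl0 h1 ((J l)^[k] u)
      obtain ⟨y, hy, hyf, hyJ⟩ := gn_res hA hJ l hl0 h1 ((J l)^[k] v)
      rw [hxJ, hyJ] at hpick hiter
      have hxc : MemLpClosure μ (ENNReal.ofReal q) (Prod.fst '' A) x.1 := gn_memcl ⟨x, hx, rfl⟩
      have hyc : MemLpClosure μ (ENNReal.ofReal q) (Prod.fst '' A) y.1 := gn_memcl ⟨y, hy, rfl⟩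
      -- bound in L^r
      have hr1 : eLpNorm (⇑(x.1 - y.1)) r μ ^ σ ≤ ENNReal.ofReal (B n) := by
        refine (hGN x hx y hy).trans (ENNReal.ofReal_le_ofReal ?_)
        rw [gn_toReal]
        have hbr := gn_bracket μ q hq (x.1 - y.1) (x.2 - y.2) l hl0
        have e1 : x.1 - y.1 + l • (x.2 - y.2) = (J l)^[k] u - (J l)^[k] v := by
          rw [← hxf, ← hyf, smul_sub]; abel
        rw [e1] at hbr
        have e2 : qBracket μ q (⇑(x.1 - y.1)) (⇑(x.2 - y.2)) + ω * ‖x.1 - y.1‖ ^ q ≤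
            a0 ^ q / θ ^ n / (q * t) := by
          calc _ ≤ (‖(J l)^[k] u - (J l)^[k] v‖ ^ q - ‖x.1 - y.1‖ ^ q) / (q * l)
                + ω * ‖x.1 - y.1‖ ^ q := by gcongr
            _ = (‖(J l)^[k] u - (J l)^[k] v‖ ^ q - θ * ‖x.1 - y.1‖ ^ q) / (q * l) := by
              rw [hθ]; field_simp; ring
            _ ≤ (a0 ^ q / (n * θ ^ n)) / (q * l) := by gcongr
            _ = _ := by rw [hl]; field_simp
        have e3 : ‖x.1 - y.1‖ ≤ a0 / (1 - l * ω) ^ n := by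
          rw [le_div_iff₀ (by positivity)]
          refine le_trans ?_ hiter
          gcongr ?_ * ?_
          exact pow_le_pow_of_le_one hd0.le hd1 hk
        show _ ≤ C * (a0 ^ q / θ ^ n / (q * t)) * (a0 / (1 - l * ω) ^ n) ^ ϱ
        calc _ ≤ C * (a0 ^ q / θ ^ n / (q * t)) * ‖x.1 - y.1‖ ^ ϱ := by gcongr
          _ ≤ _ := by gcongr
      have hr2 : eLpNorm (⇑(x.1 - y.1)) r μ ≤ ENNReal.ofReal (B n) ^ (1 / σ) := by
        rw [one_div]
        exact (ENNReal.le_rpow_inv_iff hσ).2 hr1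
      have hkn : ((k + 1 : ℕ) : ℝ) ≤ n := by exact_mod_cast hk
      set s : ℝ := ((k + 1 : ℕ) : ℝ) * t / n with hs
      have hs0 : 0 ≤ s := by positivity
      have hst : s ≤ t := by
        rw [hs, div_le_iff₀ hn', mul_comm]; gcongr
      have hexp : Real.exp (ω * (t - s)) ≤ Real.exp (ω * t) := by
        apply Real.exp_le_exp.2; gcongr; linarith
      have hexp2 : Real.exp ((t - s) * ω) ≤ Real.exp (ω * t) := by rwa [mul_comm]
      have hcl : ∀ z, MemLpClosure μ (ENNReal.ofReal q) (Prod.fst '' A) z → ∀ w,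
          MemLpClosure μ (ENNReal.ofReal q) (Prod.fst '' A) w → w = (J l)^[k + 1] z →
          ‖T (t - s) w - T t z‖ₑ ≤ ENNReal.ofReal (Real.exp (ω * t)) * S z n := by
        intro z hz w hw hwz
        have hTt : T t z = T (t - s) (T s z) := by
          rw [← hTs s (t - s) hs0 (by linarith) z hz]; congr 1; ring
        have h3 := gn_T_lip hA hT (t - s) (by linarith) w (T s z) hw (hTm s hs0 z hz)
        have h4 := le_iSup₂ (f := fun (k : ℕ) (_ : k ∈ Finset.range (n + 1)) =>
          eLpNorm (⇑((J (t / (n : ℝ)))^[k] z - T ((k : ℝ) * t / (n : ℝ)) z))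
            (ENNReal.ofReal q) μ) (k + 1) (by simp; omega)
        have h5 : ‖w - T s z‖ₑ ≤ S z n := by
          rw [Lp.enorm_def, hwz]; exact h4
        rw [hTt]
        calc ‖T (t - s) w - T (t - s) (T s z)‖ₑ
            = ENNReal.ofReal ‖T (t - s) w - T (t - s) (T s z)‖ := (ofReal_norm _).symm
          _ ≤ ENNReal.ofReal (Real.exp (ω * t) * ‖w - T s z‖) := by
            apply ENNReal.ofReal_le_ofReal
            refine h3.trans ?_
            gcongr
          _ = ENNReal.ofReal (Real.exp (ω * t)) * ‖w - T s z‖ₑ := by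
            rw [ENNReal.ofReal_mul (Real.exp_pos _).le, ofReal_norm]
          _ ≤ _ := by gcongr
      refine ⟨T (t - s) x.1 - T (t - s) y.1, ?_, ?_⟩
      · refine (hgrow (t - s) (by linarith) x.1 y.1 hxc hyc).trans ?_
        gcongr
      · have hu1 := hcl u hu x.1 hxc (by rw [Function.iterate_succ_apply', hxJ])
        have hv1 := hcl v hv y.1 hyc (by rw [Function.iterate_succ_apply', hyJ])
        rw [sub_sub_sub_comm, mul_add]
        exact enorm_sub_le.trans (add_le_add hu1 hv1)
  refine main.trans (le_of_eq ?_)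
  rw [← Lp.enorm_def, ← ofReal_norm, ← ha0]
  have hBinf0 : 0 ≤ Binf := by positivity
  have ha00 : 0 ≤ a0 := norm_nonneg _
  rw [ENNReal.ofReal_rpow_of_nonneg hBinf0 (by positivity),
    ENNReal.ofReal_rpow_of_nonneg ha00 (by positivity),
    ← ENNReal.ofReal_mul (by positivity), ← ENNReal.ofReal_mul (by positivity)]
  congr 1
  have e1 : Binf = (C / q) * t⁻¹ * Real.exp (t * (q * ω) + t * ω * ϱ) * a0 ^ (q + ϱ) := by
    show C * (a0 ^ q / Real.exp (-(t * (q * ω))) / (q * t)) *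
      (a0 / Real.exp (-(t * ω))) ^ ϱ = _
    rw [Real.div_rpow ha00 (Real.exp_pos _).le, ← Real.exp_mul, Real.rpow_add_of_nonneg ha00
      hq0.le hϱ, Real.exp_add, neg_mul, Real.exp_neg, Real.exp_neg]
    field_simp
  rw [e1, Real.mul_rpow (by positivity) (by positivity), Real.mul_rpow (by positivity)
    (by positivity), Real.mul_rpow (by positivity) (by positivity), ← Real.exp_mul,
    ← Real.rpow_mul ha00, Real.inv_rpow ht.le, Real.rpow_neg ht.le]
  rw [show ω * ((q + ϱ) / σ + 1) * t = ω * t + (t * (q * ω) + t * ω * ϱ) * (1 / σ) by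
    field_simp; ring, Real.exp_add, mul_one_div (q + ϱ) σ]
  ring

end Statement0
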